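/- Let m ≥ 5 be odd and let u be a positive integer with gcd(u, m) = 1. Suppose either (m² − 1)/8 is even and ρ = 0, or (m² − 1)/8 is odd and ρ = 1. Then C_{D_ρ} is a binary projective three-weight linear code of length 2^{m−2} − 2^{(m−3)/2}, dimension m and minimum distance 2^{m−3} − 2^{(m−3)/2}, and its weight distribution is: A_{2^{m−3}−2^{(m−3)/2}} = 2^{m−1} − 1, A_{2^{m−3}} = 2^{m−1} − 1, A_{2^{m−2}−2^{(m−3)/2}} = 1, and A_i = 0 for all other i ≥ 1. -/

import Mathlib

/-- Hamming weight of a binary vector: the number of nonzero coordinates. -/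
noncomputable def wt {ι : Type*} (c : ι → ZMod 2) : ℕ := Nat.card {i : ι // c i ≠ 0}

/-- Number of codewords of Hamming weight `w` in a set of binary vectors. -/
noncomputable def weightCount {ι : Type*} (C : Set (ι → ZMod 2)) (w : ℕ) : ℕ :=
  Nat.card {c : ι → ZMod 2 // c ∈ C ∧ wt c = w}

/-- The dual code: all vectors orthogonal (standard inner product) to every codeword. -/
def dualCode {ι : Type*} (C : Set (ι → ZMod 2)) : Set (ι → ZMod 2) :=
  {x | ∀ c ∈ C, ∑ᶠ i, x i * c i = 0}

/-- A code is projective if the minimum distance of its dual is at least 3. -/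
def IsProjective {ι : Type*} (C : Set (ι → ZMod 2)) : Prop :=
  ∀ x ∈ dualCode C, x ≠ 0 → 3 ≤ wt x

/-- `d` is the minimum distance of `C`: the least Hamming weight of a nonzero codeword. -/
def IsMinDist {ι : Type*} (C : Set (ι → ZMod 2)) (d : ℕ) : Prop :=
  (∃ c ∈ C, c ≠ 0 ∧ wt c = d) ∧ ∀ c ∈ C, c ≠ 0 → d ≤ wt c

/-- The number of nonzero Hamming weights occurring among codewords of `C`. -/
noncomputable def numNonzeroWeights {ι : Type*} (C : Set (ι → ZMod 2)) : ℕ :=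
  Nat.card {i : ℕ | 1 ≤ i ∧ weightCount C i ≠ 0}

/-- The codewords of weight `w` in `C` hold a 2-design with index `lam`: every pair of
distinct coordinate positions lies in the support of exactly `lam` codewords of weight `w`. -/
def HoldsTwoDesign {ι : Type*} (C : Set (ι → ZMod 2)) (w lam : ℕ) : Prop :=
  ∀ p q : ι, p ≠ q →
    Nat.card {c : ι → ZMod 2 // c ∈ C ∧ wt c = w ∧ c p ≠ 0 ∧ c q ≠ 0} = lam

/-- The defining set `D_ρ = {x ∈ F_{2^m} : Tr(x) = 1, Tr(x^{2^u+1}) = ρ}`. -/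
def Dset (m u : ℕ) (ρ : ZMod 2) : Set (GaloisField 2 m) :=
  {x | Algebra.trace (ZMod 2) (GaloisField 2 m) x = 1 ∧
       Algebra.trace (ZMod 2) (GaloisField 2 m) (x ^ (2 ^ u + 1)) = ρ}

/-- The linear map `b ↦ (Tr(b·d))_{d ∈ D_ρ}`. -/
noncomputable def codeMap (m u : ℕ) (ρ : ZMod 2) :
    GaloisField 2 m →ₗ[ZMod 2] (↥(Dset m u ρ) → ZMod 2) :=
  LinearMap.pi fun d =>
    (Algebra.trace (ZMod 2) (GaloisField 2 m)).comp
      (LinearMap.mulRight (ZMod 2) (d : GaloisField 2 m))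

/-- The code `C_{D_ρ} = {(Tr(b·d))_{d ∈ D_ρ} : b ∈ F_{2^m}}`. -/
noncomputable def codeD (m u : ℕ) (ρ : ZMod 2) :
    Submodule (ZMod 2) (↥(Dset m u ρ) → ZMod 2) :=
  LinearMap.range (codeMap m u ρ)

noncomputable section GoldSums

open Finset

/-- The sign `(-1)^a`. -/
def sg (a : ZMod 2) : ℤ := if a = 0 then 1 else -1

lemma sg_zero : sg 0 = 1 := by decide
lemma sg_one : sg 1 = -1 := by decide
lemma sg_add : ∀ a b : ZMod 2, sg (a + b) = sg a * sg b := by decide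
lemma sg_sq : ∀ a : ZMod 2, sg a * sg a = 1 := by decide
lemma zmod2_cases : ∀ a : ZMod 2, a = 0 ∨ a = 1 := by decide

variable {F : Type} [Field F] [Fintype F] [Algebra (ZMod 2) F]

local notation "Tr" => Algebra.trace (ZMod 2) F

lemma charTwo : CharP F 2 := charP_of_injective_algebraMap (algebraMap (ZMod 2) F).injective 2

lemma add_self_F (x : F) : x + x = 0 := by
  have := charTwo (F := F)
  exact CharTwo.add_self_eq_zero x

lemma tr_pow (x : F) (k : ℕ) : Tr (x ^ 2 ^ k) = Tr x := by
  have h := Algebra.trace_eq_of_algEquiv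
    ((FiniteField.frobeniusAlgEquivOfAlgebraic (ZMod 2) F) ^ k) x
  rw [AlgEquiv.coe_pow, FiniteField.coe_frobeniusAlgEquivOfAlgebraic_iterate, ZMod.card] at h
  exact h

lemma tr_nondeg {a : F} (ha : ∀ b, Tr (a * b) = 0) : a = 0 := by
  have htr := (traceForm_nondegenerate (ZMod 2) F).1 a
  simp_rw [Algebra.traceForm_apply] at htr
  exact htr ha

lemma card_F : (Fintype.card F : ℤ) = 2 ^ Module.finrank (ZMod 2) F := by
  have := Module.card_eq_pow_finrank (K := ZMod 2) (V := F)
  rw [this, ZMod.card]; push_cast; rfl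

lemma tr_one (h : Odd (Module.finrank (ZMod 2) F)) : Tr (1 : F) = 1 := by
  have := Algebra.trace_algebraMap (S := F) (1 : ZMod 2)
  rw [map_one] at this
  rw [this, nsmul_eq_mul, mul_one]
  exact ZMod.natCast_eq_one_iff_odd.mpr h

open Classical in
lemma sum_sg (a : F) : ∑ x : F, sg (Tr (a * x)) = if a = 0 then (Fintype.card F : ℤ) else 0 := by
  split_ifs with h
  · simp [h, sg_zero]
  · obtain ⟨b, hb⟩ : ∃ b, Tr (a * b) ≠ 0 := by
      by_contra! hc
      exact h (tr_nondeg hc)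
    have hb1 : Tr (a * b) = 1 := (zmod2_cases _).resolve_left hb
    have h1 : ∑ x : F, sg (Tr (a * x)) = ∑ x : F, sg (Tr (a * (x + b))) :=
      (Equiv.sum_comp (Equiv.addRight b) (fun x => sg (Tr (a * x)))).symm
    simp only [mul_add, map_add, sg_add, hb1, sg_one, mul_neg, mul_one, sum_neg_distrib] at h1
    linarith

/-- The Gold form. -/
def gQ (F : Type) [Field F] [Algebra (ZMod 2) F] (u : ℕ) (x : F) : ZMod 2 :=
  Algebra.trace (ZMod 2) F (x ^ (2 ^ u + 1))

def gS (F : Type) [Field F] [Fintype F] [Algebra (ZMod 2) F] (u : ℕ) (b : F) : ℤ :=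
  ∑ x : F, sg (gQ F u x + Algebra.trace (ZMod 2) F (b * x))

lemma gQ_add (u : ℕ) (x z : F) :
    gQ F u (x + z) = gQ F u x + gQ F u z + Tr ((z + z ^ 2 ^ (2 * u)) * x ^ 2 ^ u) := by
  have := charTwo (F := F)
  have h1 : Tr (x * z ^ 2 ^ u) = Tr (z ^ 2 ^ (2 * u) * x ^ 2 ^ u) := by
    rw [← tr_pow _ u, mul_pow, ← pow_mul, ← pow_add, mul_comm, two_mul]
  unfold gQ
  rw [pow_succ, add_pow_char_pow, add_mul (z), map_add Tr (z * _), ← h1, ← map_add, ← map_add,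
    ← map_add]
  congr 1
  ring

lemma fix_iff {k m : ℕ} (hm : Module.finrank (ZMod 2) F = m) (hk : Nat.gcd k m = 1) (z : F) :
    z ^ 2 ^ k = z ↔ z = 0 ∨ z = 1 := by
  constructor
  · intro h
    have h2 : z ^ 2 ^ m = z := by
      have := FiniteField.pow_card z
      rwa [Module.card_eq_pow_finrank (K := ZMod 2) (V := F), ZMod.card, hm] at this
    have e : ∀ n, z ^ 2 ^ n = z ↔ Function.IsPeriodicPt (fun y : F => y ^ 2) n z := by
      intro n
      rw [Function.IsPeriodicPt, Function.IsFixedPt, pow_iterate]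
    have h3 := ((e k).1 h).gcd ((e m).1 h2)
    rw [hk, ← e 1] at h3
    have : z * (z - 1) = 0 := by ring_nf; simp at h3; rw [h3]; ring
    rcases mul_eq_zero.1 this with h | h
    · exact Or.inl h
    · exact Or.inr (sub_eq_zero.1 h)
  · rintro (h | h) <;> simp [h]

lemma gS_sq {u m : ℕ} (hm : Module.finrank (ZMod 2) F = m) (hodd : Odd m)
    (hu : Nat.gcd u m = 1) (b : F) :
    gS F u b * gS F u b = 2 ^ m * (1 - sg (Tr b)) := by
  classical
  have := charTwo (F := F)
  have hg : Nat.gcd (2 * u) m = 1 := by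
    apply Nat.Coprime.mul_left _ hu
    exact (Nat.coprime_two_left).2 hodd
  have h1 : gS F u b * gS F u b
      = ∑ z : F, sg (gQ F u z + Tr (b * z)) * ∑ x : F, sg (Tr ((z + z ^ 2 ^ (2 * u)) * x)) := by
    unfold gS
    rw [sum_mul_sum]
    have : ∀ x : F, ∑ y : F, sg (gQ F u x + Tr (b * x)) * sg (gQ F u y + Tr (b * y)) =
        ∑ z : F, sg (gQ F u z + Tr (b * z)) * sg (Tr ((z + z ^ 2 ^ (2 * u)) * x ^ 2 ^ u)) := by
      intro x
      rw [← Equiv.sum_comp (Equiv.addLeft x)]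
      refine sum_congr rfl fun z _ => ?_
      simp only [Equiv.coe_addLeft]
      rw [gQ_add, mul_add, map_add]
      simp only [sg_add]
      linear_combination (sg (gQ F u z) * sg (Tr (b * z)) *
        sg (Tr ((z + z ^ 2 ^ (2 * u)) * x ^ 2 ^ u)) * (sg (Tr (b * x)) * sg (Tr (b * x)))) *
        sg_sq (gQ F u x) + (sg (gQ F u z) * sg (Tr (b * z)) *
        sg (Tr ((z + z ^ 2 ^ (2 * u)) * x ^ 2 ^ u))) * sg_sq (Tr (b * x))
    rw [sum_congr rfl fun x _ => this x, sum_comm]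
    refine sum_congr rfl fun z _ => ?_
    rw [← mul_sum]
    congr 1
    have hbij : Function.Bijective (fun x : F => x ^ 2 ^ u) := by
      have hi : Function.Injective (fun x : F => x ^ 2 ^ u) :=
        iterateFrobenius_inj F 2 u
      exact Finite.injective_iff_bijective.1 hi
    exact Function.Bijective.sum_comp hbij (fun x => sg (Tr ((z + z ^ 2 ^ (2 * u)) * x)))
  rw [h1]
  simp only [sum_sg]
  have h2 : ∀ z : F, z + z ^ 2 ^ (2 * u) = 0 ↔ z = 0 ∨ z = 1 := by
    intro z
    rw [← fix_iff hm hg z, CharTwo.add_eq_zero, eq_comm]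
  simp only [h2]
  rw [← Finset.sum_subset (Finset.subset_univ ({0, 1} : Finset F))]
  · rw [Finset.sum_pair zero_ne_one]
    have h1' := tr_one (F := F) (hm ▸ hodd)
    simp [gQ, card_F, hm, h1', sg_add, sg_one, sg_zero]
    ring
  · intro x _ hx
    simp at hx
    simp [hx]

lemma gS_one_eq (u : ℕ) :
    gS F u 1 = 2 * (Fintype.card {x : F // gQ F u x + Tr x = 0} : ℤ) - Fintype.card F := by
  have h : ∀ x : F, sg (gQ F u x + Tr x) = 2 * (if gQ F u x + Tr x = 0 then 1 else 0) - 1 := by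
    intro x; unfold sg; split_ifs <;> norm_num
  unfold gS
  simp only [one_mul, h]
  rw [sum_sub_distrib, ← mul_sum, Fintype.card_subtype]
  simp

lemma gS_congr {K : Type} [Field K] [Fintype K] [Algebra (ZMod 2) K] {p k : ℕ} (u : ℕ)
    (hp : p.Prime) (hp2 : Odd p) (hK : Module.finrank (ZMod 2) K = k)
    (hF : Module.finrank (ZMod 2) F = p * k) :
    gS F u 1 ≡ gS K u 1 [ZMOD p] := by
  classical
  have : Fact p.Prime := ⟨hp⟩
  have hkpos : 0 < k := hK ▸ Module.finrank_pos
  have hdvd : Module.finrank (ZMod 2) K ∣ Module.finrank (ZMod 2) F := by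
    rw [hK, hF]; exact dvd_mul_left _ _
  obtain ⟨φ⟩ := FiniteField.nonempty_algHom_of_finrank_dvd hdvd
  let _ := φ.toRingHom.toAlgebra
  have hφ : ∀ x, algebraMap K F x = φ x := fun _ => rfl
  have : IsScalarTower (ZMod 2) K F := IsScalarTower.of_algebraMap_eq fun x => (φ.commutes x).symm
  have hKF : Module.finrank K F = p := by
    have := Module.finrank_mul_finrank (ZMod 2) K F
    rw [hK, hF, mul_comm] at this
    exact Nat.eq_of_mul_eq_mul_right hkpos this
  have htr : ∀ x : K, Algebra.trace (ZMod 2) F (φ x) = Algebra.trace (ZMod 2) K x := by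
    intro x
    rw [← Algebra.trace_trace (S := K), ← hφ, Algebra.trace_algebraMap, hKF, map_nsmul,
      nsmul_eq_mul, ZMod.natCast_eq_one_iff_odd.mpr hp2, one_mul]
  have hQ : ∀ x : K, gQ F u (φ x) = gQ K u x := by
    intro x
    unfold gQ
    rw [← map_pow, htr]
  have hcK : Fintype.card K = 2 ^ k := by
    rw [Module.card_eq_pow_finrank (K := ZMod 2) (V := K), ZMod.card, hK]
  have hcF : Fintype.card F = 2 ^ (p * k) := by
    rw [Module.card_eq_pow_finrank (K := ZMod 2) (V := F), ZMod.card, hF]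
  -- the fixed points of the Frobenius power
  have hfix : ∀ x : F, x ^ 2 ^ k = x ↔ ∃ y, φ y = x := by
    have hsub : (univ.image φ : Finset F) ⊆ univ.filter (fun x : F => x ^ 2 ^ k = x) := by
      intro x hx
      obtain ⟨y, -, rfl⟩ := mem_image.1 hx
      simp only [mem_filter, mem_univ, true_and]
      rw [← map_pow, ← hcK, FiniteField.pow_card]
    have hle : (univ.filter (fun x : F => x ^ 2 ^ k = x)).card ≤ (univ.image φ : Finset F).card := by
      have hinj : Function.Injective φ := φ.toRingHom.injective
      rw [card_image_of_injective _ hinj, card_univ, hcK]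
      have h1 : 1 < 2 ^ k := Nat.one_lt_two_pow hkpos.ne'
      have hne := FiniteField.X_pow_card_sub_X_ne_zero F h1
      have hd := FiniteField.X_pow_card_sub_X_natDegree_eq F h1
      refine le_trans (card_le_card ?_) (((Multiset.toFinset_card_le _).trans
        (Polynomial.card_roots' _)).trans hd.le)
      intro x hx
      simp only [mem_filter, mem_univ, true_and] at hx
      rw [Multiset.mem_toFinset, Polynomial.mem_roots hne]
      simp [hx]
    have heq := eq_of_subset_of_card_le hsub hle
    intro x
    have := Finset.ext_iff.1 heq x
    simp only [mem_image, mem_univ, true_and, mem_filter] at this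
    exact this.symm
  have hQp : ∀ x : F, gQ F u (x ^ 2 ^ k) + Tr (x ^ 2 ^ k) = gQ F u x + Tr x := by
    intro x
    unfold gQ
    rw [← pow_mul, mul_comm, pow_mul, tr_pow, tr_pow]
  let f : Function.End {x : F // gQ F u x + Tr x = 0} :=
    fun x => ⟨x.1 ^ 2 ^ k, (hQp x.1).trans x.2⟩
  have hfi : ∀ (n : ℕ) x, ((f ^ n : Function.End _) x).1 = x.1 ^ 2 ^ (n * k) := by
    intro n
    induction n with
    | zero => intro x; rw [pow_zero, zero_mul, pow_zero, pow_one]; rfl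
    | succ n ih =>
      intro x
      rw [pow_succ]
      change ((f ^ n : Function.End _) (f x)).1 = _
      rw [ih]
      change (x.1 ^ 2 ^ k) ^ 2 ^ (n * k) = _
      rw [← pow_mul, ← pow_add]
      congr 2
      ring
  have hfp : f ^ p ^ 1 = 1 := by
    funext x
    apply Subtype.ext
    rw [hfi, pow_one, ← hcF, FiniteField.pow_card]
    rfl
  have hmod := Equiv.Perm.card_fixedPoints_modEq hfp
  have hcard : Fintype.card f.fixedPoints
      = Fintype.card {x : K // gQ K u x + Algebra.trace (ZMod 2) K x = 0} := by
    symm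
    refine Fintype.card_of_bijective (f := fun x => ⟨⟨φ x.1, by rw [hQ, htr]; exact x.2⟩,
      Subtype.ext ((hfix _).2 ⟨x.1, rfl⟩)⟩) ⟨?_, ?_⟩
    · intro x y h
      have := congrArg (fun z => z.1.1) h
      exact Subtype.ext (φ.injective this)
    · rintro ⟨⟨x, hx⟩, hx2⟩
      obtain ⟨y, rfl⟩ := (hfix x).1 (congrArg Subtype.val hx2)
      exact ⟨⟨y, by rwa [hQ, htr] at hx⟩, rfl⟩
  rw [hcard] at hmod
  rw [gS_one_eq, gS_one_eq]
  have hmod' := Int.natCast_modEq_iff.2 hmod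
  refine Int.ModEq.sub (Int.ModEq.mul_left _ hmod') ?_
  rw [hcK, hcF]
  apply Int.natCast_modEq_iff.2
  rw [← ZMod.natCast_eq_natCast_iff]
  push_cast
  rw [mul_comm, pow_mul, ZMod.pow_card]

theorem gS_one (n : ℕ) : ∀ (F : Type) [Field F] [Fintype F] [Algebra (ZMod 2) F] (m u : ℕ),
    m ≤ n → Module.finrank (ZMod 2) F = m → Odd m → Nat.gcd u m = 1 →
    gS F u 1 = jacobiSym 2 m * 2 ^ ((m + 1) / 2) := by
  induction n with
  | zero =>
    intro F _ _ _ m u hmn hm hodd hu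
    obtain rfl : m = 0 := by omega
    simp at hodd
  | succ n ih =>
    intro F _ _ _ m u hmn hm hodd hu
    have hmpos : 0 < m := hodd.pos
    by_cases hm1 : m = 1
    · subst hm1
      have hpow : ∀ x : F, ∀ k, x ^ 2 ^ k = x := by
        intro x k
        have h2 : x ^ 2 = x := by
          have := FiniteField.pow_card x
          rwa [Module.card_eq_pow_finrank (K := ZMod 2) (V := F), ZMod.card, hm, pow_one] at this
        induction k with
        | zero => simp
        | succ k ih => rw [pow_succ, pow_mul, ih, h2]
      have h0 : ∀ x : F, gQ F u x + Algebra.trace (ZMod 2) F (1 * x) = 0 := by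
        intro x
        have hx2 : x * x = x := by
          have := hpow x 1
          rwa [pow_one, pow_two] at this
        unfold gQ
        rw [pow_succ, hpow, one_mul, ← map_add, hx2, add_self_F, map_zero]
      unfold gS
      simp only [h0, sg_zero, sum_const, card_univ, nsmul_eq_mul, mul_one]
      rw [card_F, hm]
      simp
    · obtain ⟨p, hp, k, rfl⟩ : ∃ p, p.Prime ∧ p ∣ m := Nat.exists_prime_and_dvd hm1
      have hfp : Fact p.Prime := ⟨hp⟩
      rw [Nat.odd_mul] at hodd
      obtain ⟨hpo, hko⟩ := hodd
      have hkpos := hko.pos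
      have hk0 : k ≠ 0 := by omega
      have hp3 : 3 ≤ p := by
        rcases hpo with ⟨r, rfl⟩
        have := hp.two_le
        omega
      have hklt : k ≤ n := by nlinarith
      have huk : Nat.gcd u k = 1 := Nat.Coprime.coprime_mul_left_right hu
      have hfr := GaloisField.finrank 2 hk0
      let _ : Fintype (GaloisField 2 k) := Fintype.ofFinite _
      have hK := ih (GaloisField 2 k) k u hklt hfr hko huk
      have hc := gS_congr (F := F) (K := GaloisField 2 k) u hp hpo hfr hm
      have hsq := gS_sq hm (hpo.mul hko) hu (1 : F)
      rw [tr_one (hm ▸ hpo.mul hko), sg_one] at hsq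
      obtain ⟨a, ha⟩ := hpo
      obtain ⟨b, hb⟩ := hko
      have hk2 : (k + 1) / 2 = b + 1 := by omega
      have hpk : p * k = 2 * (a * k + b) + 1 := by
        rw [ha]; nlinarith
      have hpk2 : (p * k + 1) / 2 = a * k + b + 1 := by omega
      have hp2 : p / 2 = a := by omega
      rw [hpk2]
      rw [hK, hk2] at hc
      have hcases : gS F u 1 = 2 ^ (a * k + b + 1) ∨ gS F u 1 = - 2 ^ (a * k + b + 1) := by
        apply mul_self_eq_mul_self_iff.1
        rw [hsq, hpk]
        ring
      have : NeZero p := ⟨hp.ne_zero⟩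
      have : NeZero k := ⟨hk0⟩
      have hJ : jacobiSym 2 (p * k) = jacobiSym 2 p * jacobiSym 2 k := jacobiSym.mul_right 2 p k
      have hodd1 : Odd k := ⟨b, hb⟩
      have hodd2 : Odd p := ⟨a, ha⟩
      have hJk : jacobiSym 2 k = 1 ∨ jacobiSym 2 k = -1 := by
        apply jacobiSym.eq_one_or_neg_one
        have := Nat.coprime_two_left.2 hodd1
        simpa [Int.gcd] using this
      have hJp : jacobiSym 2 p = 1 ∨ jacobiSym 2 p = -1 := by
        apply jacobiSym.eq_one_or_neg_one
        have := Nat.coprime_two_left.2 hodd2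
        simpa [Int.gcd] using this
      have hL : ((jacobiSym 2 p : ℤ) : ZMod p) = 2 ^ a := by
        rw [← jacobiSym.legendreSym.to_jacobiSym, legendreSym.eq_pow, hp2]
        norm_cast
      have hc' := (ZMod.intCast_eq_intCast_iff _ _ _).2 hc
      have h2ne : (2 : ZMod p) ≠ 0 := by
        intro h
        have : (p : ℕ) ∣ 2 := (ZMod.natCast_eq_zero_iff 2 p).1 (by exact_mod_cast h)
        have := Nat.le_of_dvd (by norm_num) this
        omega
      have h2p : (2 : ZMod p) ^ (a * k + b + 1) = (jacobiSym 2 p : ℤ) * 2 ^ (b + 1) := by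
        rw [add_assoc, pow_add, pow_mul, ← hL]
        congr 1
        rcases hJp with h | h <;> rw [h] <;> push_cast
        · simp
        · exact hodd1.neg_one_pow
      have hpne : (2 : ZMod p) ^ (b + 1) ≠ 0 := pow_ne_zero _ h2ne
      have h11 : (1 : ZMod p) ≠ -1 := by
        intro h
        apply h2ne
        linear_combination h
      rw [hJ]
      rcases hcases with h | h <;> rw [h] at hc' ⊢ <;> push_cast at hc' <;> rw [h2p] at hc' <;>
        rcases hJp with h1 | h1 <;> rcases hJk with h2 | h2 <;> rw [h1, h2] at hc' ⊢ <;>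
        first
        | ring1
        | (exfalso
           apply h11
           apply mul_right_cancel₀ hpne
           push_cast at hc'
           first | linear_combination hc' | linear_combination -hc')

lemma ind1 : ∀ a : ZMod 2, 1 - sg a = if a = 1 then 2 else 0 := by decide
lemma ind2 : ∀ r a : ZMod 2, 1 + sg r * sg a = if a = r then 2 else 0 := by decide

lemma wt_formula (m u : ℕ) [Fintype (GaloisField 2 m)] (ρ : ZMod 2) (b : GaloisField 2 m) :
    8 * (wt (codeMap m u ρ b) : ℤ) =
      (∑ x : GaloisField 2 m, sg (Algebra.trace (ZMod 2) _ ((0 : GaloisField 2 m) * x))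
        - ∑ x : GaloisField 2 m, sg (Algebra.trace (ZMod 2) _ ((1 : GaloisField 2 m) * x))
        - ∑ x : GaloisField 2 m, sg (Algebra.trace (ZMod 2) _ (b * x))
        + ∑ x : GaloisField 2 m, sg (Algebra.trace (ZMod 2) _ ((b + 1) * x)))
      + sg ρ * (gS (GaloisField 2 m) u 0 - gS (GaloisField 2 m) u 1
        - gS (GaloisField 2 m) u b + gS (GaloisField 2 m) u (b + 1)) := by
  classical
  have e : {i : Dset m u ρ // codeMap m u ρ b i ≠ 0} ≃
      {x : GaloisField 2 m // (Algebra.trace (ZMod 2) _ x = 1 ∧ gQ _ u x = ρ) ∧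
        Algebra.trace (ZMod 2) _ (b * x) = 1} :=
    { toFun := fun i => ⟨i.1.1, ⟨i.1.2, (zmod2_cases _).resolve_left i.2⟩⟩
      invFun := fun x => ⟨⟨x.1, x.2.1⟩, by
        have h : codeMap m u ρ b ⟨x.1, x.2.1⟩ = 1 := x.2.2
        rw [h]; exact one_ne_zero⟩
      left_inv := fun i => rfl
      right_inv := fun i => rfl }
  have h1 : (wt (codeMap m u ρ b) : ℤ) = ∑ x : GaloisField 2 m,
      if ((Algebra.trace (ZMod 2) _ x = 1 ∧ gQ _ u x = ρ) ∧
        Algebra.trace (ZMod 2) _ (b * x) = 1) then 1 else 0 := by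
    unfold wt
    rw [Nat.card_congr e, Nat.card_eq_fintype_card, Fintype.card_subtype]
    simp
  rw [h1, mul_sum]
  unfold gS
  simp only [← sum_sub_distrib, ← sum_add_distrib, mul_sum]
  refine sum_congr rfl fun x _ => ?_
  have h2 : (8 * if ((Algebra.trace (ZMod 2) _ x = 1 ∧ gQ _ u x = ρ) ∧
        Algebra.trace (ZMod 2) _ (b * x) = 1) then 1 else 0 : ℤ) =
      (1 - sg (Algebra.trace (ZMod 2) _ x)) * (1 + sg ρ * sg (gQ _ u x)) *
        (1 - sg (Algebra.trace (ZMod 2) _ (b * x))) := by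
    rw [ind1, ind1, ind2]
    split_ifs <;> tauto
  rw [h2]
  simp only [add_mul, zero_mul, one_mul, map_add, map_zero, sg_add, sg_zero]
  ring

/-- Arithmetic consequences: weights of all codewords. -/
lemma wt_values (m u n : ℕ) (hn : m = 2 * n + 3) (hgcd : Nat.gcd u m = 1) (ρ : ZMod 2)
    (hρ : (Even ((m ^ 2 - 1) / 8) ∧ ρ = 0) ∨ (Odd ((m ^ 2 - 1) / 8) ∧ ρ = 1)) :
    ((wt (codeMap m u ρ 1) : ℤ) = 2 * (2 ^ n) ^ 2 - 2 ^ n) ∧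
    (∀ b : GaloisField 2 m, b ≠ 0 → b ≠ 1 →
      ((wt (codeMap m u ρ b) : ℤ) = (2 ^ n) ^ 2 - 2 ^ n ∨
       (wt (codeMap m u ρ b) : ℤ) = (2 ^ n) ^ 2) ∧
      (wt (codeMap m u ρ b) : ℤ) + wt (codeMap m u ρ (b + 1)) = 2 * (2 ^ n) ^ 2 - 2 ^ n) := by
  classical
  let _ : Fintype (GaloisField 2 m) := Fintype.ofFinite _
  have hodd : Odd m := ⟨n + 1, by omega⟩
  have hfr : Module.finrank (ZMod 2) (GaloisField 2 m) = m := GaloisField.finrank 2 (by omega)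
  have hJ : jacobiSym 2 m = sg ρ := by
    rw [jacobiSym.at_two hodd, ZMod.χ₈_nat_eq_if_mod_eight]
    obtain ⟨j, r, hr, hj⟩ : ∃ j r, r < 8 ∧ m = 8 * j + r :=
      ⟨m / 8, m % 8, Nat.mod_lt _ (by norm_num), by omega⟩
    have hm8 : m % 8 = r := by omega
    have hm2 : m % 2 = 1 := Nat.odd_iff.1 hodd
    rw [hm8, hm2]
    have hr2 : r % 2 = 1 := by omega
    have key : ∀ s, r ^ 2 = 8 * s + 1 → (m ^ 2 - 1) / 8 = 2 * (4 * j * j + j * r) + s := by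
      intro s hs
      have : m ^ 2 = 8 * (2 * (4 * j * j + j * r) + s) + 1 := by
        rw [hj]; ring_nf; ring_nf at hs; omega
      omega
    rcases hρ with ⟨h, rfl⟩ | ⟨h, rfl⟩
    · rw [Nat.even_iff] at h
      interval_cases r <;> simp at hr2 <;> simp [sg_zero]
      · rw [key 1 (by norm_num)] at h; omega
      · rw [key 3 (by norm_num)] at h; omega
    · rw [Nat.odd_iff] at h
      interval_cases r <;> simp at hr2 <;> simp [sg_one]
      · rw [key 0 (by norm_num)] at h; omega
      · rw [key 6 (by norm_num)] at h; omega
  have hq : (Fintype.card (GaloisField 2 m) : ℤ) = 8 * (2 ^ n) ^ 2 := by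
    rw [card_F, hfr, hn]; ring
  have hS1 : gS (GaloisField 2 m) u 1 = sg ρ * (4 * 2 ^ n) := by
    rw [gS_one m _ m u le_rfl hfr hodd hgcd, hJ]
    have : (m + 1) / 2 = n + 2 := by omega
    rw [this]; ring
  have hsq := fun b => gS_sq (F := GaloisField 2 m) hfr hodd hgcd b
  have h2m : (2 : ℤ) ^ m = 8 * (2 ^ n) ^ 2 := by rw [hn]; ring
  have hz : ∀ b : GaloisField 2 m, Algebra.trace (ZMod 2) _ b = 0 →
      gS (GaloisField 2 m) u b = 0 := by
    intro b hb
    have := hsq b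
    rw [hb, sg_zero] at this
    simpa using this
  have ho : ∀ b : GaloisField 2 m, Algebra.trace (ZMod 2) _ b = 1 →
      gS (GaloisField 2 m) u b = 4 * 2 ^ n ∨ gS (GaloisField 2 m) u b = - (4 * 2 ^ n) := by
    intro b hb
    apply mul_self_eq_mul_self_iff.1
    rw [hsq b, hb, sg_one, h2m]
    ring
  have ht1 := tr_one (F := GaloisField 2 m) (by rw [hfr]; exact hodd)
  have hc2 := charTwo (F := GaloisField 2 m)
  have hs := sg_sq ρ
  have hs' : sg ρ = 1 ∨ sg ρ = -1 := mul_self_eq_one_iff.1 hs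
  have h11 : (1 : GaloisField 2 m) + 1 = 0 := add_self_F 1
  have hS0 := hz 0 (map_zero _)
  refine ⟨?_, ?_⟩
  · have h := wt_formula m u ρ 1
    simp only [sum_sg, h11, hS0, hS1, one_ne_zero, if_true, if_false, hq] at h
    apply mul_left_cancel₀ (show (8 : ℤ) ≠ 0 by norm_num)
    linear_combination h - 8 * 2 ^ n * hs
  · intro b hb0 hb1
    have hb1' : b + 1 ≠ 0 := by
      intro h; exact hb1 (CharTwo.add_eq_zero.1 h)
    have hb2 : b + 1 + 1 = b := by rw [add_assoc, h11, add_zero]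
    have h := wt_formula m u ρ b
    have h' := wt_formula m u ρ (b + 1)
    simp only [sum_sg, hb2, hb0, hb1', hS0, hS1, one_ne_zero, if_true, if_false, hq] at h h'
    refine ⟨?_, ?_⟩
    · rcases zmod2_cases (Algebra.trace (ZMod 2) _ b) with hb | hb
      · have e1 := hz b hb
        have e2 := ho (b + 1) (by rw [map_add, hb, ht1]; rfl)
        rw [e1] at h
        rcases e2 with e2 | e2 <;> rw [e2] at h <;> rcases hs' with e | e <;> rw [e] at h <;>
          ring_nf at h ⊢ <;> omega
      · have e1 := hz (b + 1) (by rw [map_add, hb, ht1]; rfl)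
        have e2 := ho b hb
        rw [e1] at h
        rcases e2 with e2 | e2 <;> rw [e2] at h <;> rcases hs' with e | e <;> rw [e] at h <;>
          ring_nf at h ⊢ <;> omega
    · apply mul_left_cancel₀ (show (8 : ℤ) ≠ 0 by norm_num)
      linear_combination h + h' - 8 * 2 ^ n * hs

lemma wt_zero (m u : ℕ) (ρ : ZMod 2) : wt (codeMap m u ρ 0) = 0 := by
  unfold wt
  rw [map_zero]
  simp

lemma projective_aux (m u : ℕ) (hm : m ≠ 0) (ρ : ZMod 2) :
    IsProjective (codeD m u ρ : Set (↥(Dset m u ρ) → ZMod 2)) := by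
  classical
  let _ : Fintype (GaloisField 2 m) := Fintype.ofFinite _
  let _ : Fintype (Dset m u ρ) := Fintype.ofFinite _
  intro x hx hx0
  have hx' : ∀ b : GaloisField 2 m, ∑ i : Dset m u ρ, x i * Algebra.trace (ZMod 2) _ (b * i.1) = 0 := by
    intro b
    have := hx (codeMap m u ρ b) ⟨b, rfl⟩
    rwa [finsum_eq_sum_of_fintype] at this
  have hsum : ∑ i ∈ univ.filter (fun i => x i ≠ 0), i.1 = 0 := by
    apply tr_nondeg
    intro b
    rw [mul_comm, mul_sum, map_sum, sum_filter]
    refine Eq.trans ?_ (hx' b)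
    refine sum_congr rfl fun i _ => ?_
    rcases zmod2_cases (x i) with h | h <;> simp [h]
  unfold wt
  rw [Nat.card_eq_fintype_card, Fintype.card_subtype]
  by_contra! hlt
  have hc : (univ.filter (fun i => x i ≠ 0)).card = 0 ∨ (univ.filter (fun i => x i ≠ 0)).card = 1 ∨
    (univ.filter (fun i => x i ≠ 0)).card = 2 := by omega
  rcases hc with h | h | h
  · rw [card_eq_zero, filter_eq_empty_iff] at h
    apply hx0
    funext i
    simpa using h (mem_univ i)
  · obtain ⟨d, hd⟩ := card_eq_one.1 h
    rw [hd, sum_singleton] at hsum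
    have := d.2.1
    rw [hsum, map_zero] at this
    exact zero_ne_one this
  · obtain ⟨d, e, hde, hd⟩ := card_eq_two.1 h
    rw [hd, sum_pair hde] at hsum
    have hc2 := charTwo (F := GaloisField 2 m)
    exact hde (Subtype.ext (CharTwo.add_eq_zero.1 hsum))

lemma weightCount_eq (m u : ℕ) (ρ : ZMod 2) (hinj : Function.Injective (codeMap m u ρ)) (w : ℕ) :
    weightCount (codeD m u ρ : Set (↥(Dset m u ρ) → ZMod 2)) w =
      Nat.card {b : GaloisField 2 m // wt (codeMap m u ρ b) = w} := by
  unfold weightCount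
  symm
  refine Nat.card_eq_of_bijective (fun b => ⟨codeMap m u ρ b.1, ⟨b.1, rfl⟩, b.2⟩) ⟨?_, ?_⟩
  · intro x y h
    exact Subtype.ext (hinj (congrArg Subtype.val h))
  · rintro ⟨c, ⟨b, rfl⟩, hb⟩
    exact ⟨⟨b, hb⟩, rfl⟩

end GoldSums

theorem codeD_three_weight_minus (m u : ℕ) (hm : 5 ≤ m) (hmodd : Odd m) (hu : 0 < u)
    (hgcd : Nat.gcd u m = 1) (ρ : ZMod 2)
    (hρ : (Even ((m ^ 2 - 1) / 8) ∧ ρ = 0) ∨ (Odd ((m ^ 2 - 1) / 8) ∧ ρ = 1)) :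
    Nat.card (Dset m u ρ) = 2 ^ (m - 2) - 2 ^ ((m - 3) / 2) ∧
    Module.finrank (ZMod 2) (codeD m u ρ) = m ∧
    IsMinDist (codeD m u ρ : Set (↥(Dset m u ρ) → ZMod 2)) (2 ^ (m - 3) - 2 ^ ((m - 3) / 2)) ∧
    IsProjective (codeD m u ρ : Set (↥(Dset m u ρ) → ZMod 2)) ∧
    numNonzeroWeights (codeD m u ρ : Set (↥(Dset m u ρ) → ZMod 2)) = 3 ∧
    weightCount (codeD m u ρ : Set (↥(Dset m u ρ) → ZMod 2)) (2 ^ (m - 3) - 2 ^ ((m - 3) / 2)) = 2 ^ (m - 1) - 1 ∧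
    weightCount (codeD m u ρ : Set (↥(Dset m u ρ) → ZMod 2)) (2 ^ (m - 3)) = 2 ^ (m - 1) - 1 ∧
    weightCount (codeD m u ρ : Set (↥(Dset m u ρ) → ZMod 2)) (2 ^ (m - 2) - 2 ^ ((m - 3) / 2)) = 1 ∧
    ∀ i : ℕ, 1 ≤ i → i ≠ 2 ^ (m - 3) - 2 ^ ((m - 3) / 2) → i ≠ 2 ^ (m - 3) →
      i ≠ 2 ^ (m - 2) - 2 ^ ((m - 3) / 2) → weightCount (codeD m u ρ : Set (↥(Dset m u ρ) → ZMod 2)) i = 0 := by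
  classical
  obtain ⟨n, hn⟩ : ∃ n, m = 2 * n + 3 := by
    obtain ⟨r, hr⟩ := hmodd
    exact ⟨r - 1, by omega⟩
  have hn1 : 1 ≤ n := by omega
  have hm0 : m ≠ 0 := by omega
  let _ : Fintype (GaloisField 2 m) := Fintype.ofFinite _
  obtain ⟨hw1, hw⟩ := wt_values m u n hn hgcd ρ hρ
  have hw0 := wt_zero m u ρ
  have hexp : (m - 3) / 2 = n := by omega
  have hm3 : (2 : ℕ) ^ (m - 3) = (2 ^ n) ^ 2 := by
    rw [← pow_mul]; congr 1; omega
  have hm2 : (2 : ℕ) ^ (m - 2) = 2 * (2 ^ n) ^ 2 := by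
    rw [← pow_mul, ← pow_succ']; congr 1; omega
  have hm1 : (2 : ℕ) ^ (m - 1) = 4 * (2 ^ n) ^ 2 := by
    rw [← pow_mul, show (4 : ℕ) = 2 ^ 2 by norm_num, ← pow_add]; congr 1; omega
  have hmm : (2 : ℕ) ^ m = 8 * (2 ^ n) ^ 2 := by
    rw [← pow_mul, show (8 : ℕ) = 2 ^ 3 by norm_num, ← pow_add]; congr 1; omega
  have ht2 : 2 ≤ 2 ^ n := by
    calc 2 = 2 ^ 1 := rfl
      _ ≤ 2 ^ n := Nat.pow_le_pow_right (by norm_num) hn1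
  rw [hexp, hm3, hm2, hm1]
  have htt : 2 * 2 ^ n ≤ (2 ^ n) ^ 2 := by nlinarith
  generalize hT : 2 ^ n = t at *
  have hTz : (2 : ℤ) ^ n = t := by exact_mod_cast hT
  rw [hTz] at hw1 hw
  -- natural number versions
  generalize hs : t ^ 2 = s at *
  have hsz : (t : ℤ) ^ 2 = s := by exact_mod_cast hs
  rw [hsz] at hw1 hw
  have h1 : wt (codeMap m u ρ 1) = 2 * s - t := by omega
  have h2 : ∀ b : GaloisField 2 m, b ≠ 0 → b ≠ 1 →
      (wt (codeMap m u ρ b) = s - t ∨ wt (codeMap m u ρ b) = s) ∧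
      wt (codeMap m u ρ b) + wt (codeMap m u ρ (b + 1)) = 2 * s - t := by
    intro b hb0 hb1
    obtain ⟨h, h'⟩ := hw b hb0 hb1
    constructor
    · rcases h with h | h
      · left; omega
      · right; omega
    · omega
  have hpos : ∀ b : GaloisField 2 m, b ≠ 0 → s - t ≤ wt (codeMap m u ρ b) := by
    intro b hb
    by_cases hb1 : b = 1
    · rw [hb1, h1]; omega
    · rcases (h2 b hb hb1).1 with h | h <;> omega
  have hinj : Function.Injective (codeMap m u ρ) := by
    rw [injective_iff_map_eq_zero]
    intro b hb
    by_contra hne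
    have := hpos b hne
    rw [hb, ← map_zero (codeMap m u ρ), hw0] at this
    omega
  have hc2 := charTwo (F := GaloisField 2 m)
  have h11 : (1 : GaloisField 2 m) + 1 = 0 := add_self_F 1
  have hcount := weightCount_eq m u ρ hinj
  have hcard : Fintype.card (GaloisField 2 m) = 8 * s := by
    rw [← Nat.card_eq_fintype_card, GaloisField.card 2 m hm0, hmm]
  -- the two generic weight classes
  have hcA : ∀ w, Nat.card {b : GaloisField 2 m // wt (codeMap m u ρ b) = w} =
      (Finset.univ.filter (fun b : GaloisField 2 m => wt (codeMap m u ρ b) = w)).card := by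
    intro w
    rw [Nat.card_eq_fintype_card, Fintype.card_subtype]
  have hne0 : ∀ b : GaloisField 2 m, (wt (codeMap m u ρ b) = s - t ∨ wt (codeMap m u ρ b) = s) ↔
      b ≠ 0 ∧ b ≠ 1 := by
    intro b
    constructor
    · intro h
      constructor
      · rintro rfl; omega
      · rintro rfl; omega
    · intro h
      exact (h2 b h.1 h.2).1
  have hshift : ∀ b : GaloisField 2 m, b ≠ 0 → b ≠ 1 → b + 1 ≠ 0 ∧ b + 1 ≠ 1 := by
    intro b hb0 hb1
    refine ⟨fun h => hb1 (CharTwo.add_eq_zero.1 h), fun h => hb0 ?_⟩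
    simpa using h
  have hAB : (Finset.univ.filter (fun b : GaloisField 2 m => wt (codeMap m u ρ b) = s - t)).card =
      (Finset.univ.filter (fun b : GaloisField 2 m => wt (codeMap m u ρ b) = s)).card := by
    have hb2 : ∀ b : GaloisField 2 m, b + 1 + 1 = b := by
      intro b; rw [add_assoc, h11, add_zero]
    refine Finset.card_bij' (fun b _ => b + 1) (fun b _ => b + 1) ?_ ?_
      (fun b _ => hb2 b) (fun b _ => hb2 b)
    · intro b hb
      simp only [Finset.mem_filter, Finset.mem_univ, true_and] at hb ⊢
      obtain ⟨hb0, hb1⟩ := (hne0 b).1 (Or.inl hb)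
      have := (h2 b hb0 hb1).2
      omega
    · intro b hb
      simp only [Finset.mem_filter, Finset.mem_univ, true_and] at hb ⊢
      obtain ⟨hb0, hb1⟩ := (hne0 b).1 (Or.inr hb)
      have := (h2 b hb0 hb1).2
      omega
  have hABsum : (Finset.univ.filter (fun b : GaloisField 2 m => wt (codeMap m u ρ b) = s - t)).card +
      (Finset.univ.filter (fun b : GaloisField 2 m => wt (codeMap m u ρ b) = s)).card = 8 * s - 2 := by
    rw [← Finset.card_union_of_disjoint, ← Finset.filter_or]
    · have : Finset.univ.filter (fun b : GaloisField 2 m => wt (codeMap m u ρ b) = s - t ∨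
          wt (codeMap m u ρ b) = s) = Finset.univ \ {0, 1} := by
        ext b
        simp [hne0]
      rw [this, Finset.card_sdiff_of_subset (Finset.subset_univ _), Finset.card_univ, hcard,
        Finset.card_pair zero_ne_one]
    · rw [Finset.disjoint_filter]
      intro b _ h h'
      omega
  have hWA : weightCount (codeD m u ρ : Set (↥(Dset m u ρ) → ZMod 2)) (s - t) = 4 * s - 1 := by
    rw [hcount, hcA]; omega
  have hWB : weightCount (codeD m u ρ : Set (↥(Dset m u ρ) → ZMod 2)) s = 4 * s - 1 := by
    rw [hcount, hcA]; omega
  have hWC : weightCount (codeD m u ρ : Set (↥(Dset m u ρ) → ZMod 2)) (2 * s - t) = 1 := by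
    rw [hcount, hcA, Finset.card_eq_one]
    refine ⟨1, ?_⟩
    ext b
    simp only [Finset.mem_filter, Finset.mem_univ, true_and, Finset.mem_singleton]
    constructor
    · intro h
      by_contra hb1
      by_cases hb0 : b = 0
      · rw [hb0, hw0] at h; omega
      · rcases (h2 b hb0 hb1).1 with h' | h' <;> omega
    · rintro rfl; exact h1
  have hWO : ∀ i : ℕ, 1 ≤ i → i ≠ s - t → i ≠ s → i ≠ 2 * s - t →
      weightCount (codeD m u ρ : Set (↥(Dset m u ρ) → ZMod 2)) i = 0 := by
    intro i hi hA hB hC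
    rw [hcount, hcA, Finset.card_eq_zero, Finset.filter_eq_empty_iff]
    intro b _ hb
    by_cases hb0 : b = 0
    · rw [hb0, hw0] at hb; omega
    · by_cases hb1 : b = 1
      · rw [hb1, h1] at hb; omega
      · rcases (h2 b hb0 hb1).1 with h' | h' <;> omega
  refine ⟨?_, ?_, ⟨?_, ?_⟩, projective_aux m u hm0 ρ, ?_, hWA, hWB, hWC, hWO⟩
  · rw [← h1]
    unfold wt
    refine (Nat.card_congr (Equiv.subtypeUnivEquiv fun d => ?_)).symm
    have h : codeMap m u ρ 1 d = Algebra.trace (ZMod 2) _ ((1 : GaloisField 2 m) * d.1) := rfl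
    rw [h, one_mul, d.2.1]
    exact one_ne_zero
  · unfold codeD
    rw [LinearMap.finrank_range_of_inj hinj, GaloisField.finrank 2 hm0]
  · have hex : 0 < weightCount (codeD m u ρ : Set (↥(Dset m u ρ) → ZMod 2)) (s - t) := by
      rw [hWA]; omega
    unfold weightCount at hex
    obtain ⟨⟨c, hc, hcw⟩⟩ := (Nat.card_pos_iff.1 hex).1
    refine ⟨c, hc, ?_, hcw⟩
    rintro rfl
    rw [← map_zero (codeMap m u ρ), hw0] at hcw
    omega
  · rintro c ⟨b, rfl⟩ hb
    apply hpos
    rintro rfl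
    exact hb (map_zero _)
  · unfold numNonzeroWeights
    have : {i : ℕ | 1 ≤ i ∧ weightCount (codeD m u ρ : Set (↥(Dset m u ρ) → ZMod 2)) i ≠ 0} =
        (({s - t, s, 2 * s - t} : Finset ℕ) : Set ℕ) := by
      ext i
      simp only [Set.mem_setOf_eq, Finset.coe_insert, Finset.coe_singleton, Set.mem_insert_iff,
        Set.mem_singleton_iff]
      constructor
      · rintro ⟨hi, h⟩
        by_contra hcon
        push Not at hcon
        exact h (hWO i hi hcon.1 hcon.2.1 hcon.2.2)
      · rintro (rfl | rfl | rfl)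
        · rw [hWA]; omega
        · rw [hWB]; omega
        · rw [hWC]; omega
    rw [this]
    change Nat.card ((({s - t, s, 2 * s - t} : Finset ℕ) : Set ℕ) : Type) = 3
    rw [Nat.card_coe_set_eq, Set.ncard_coe_finset]
    rw [Finset.card_eq_three]
    exact ⟨_, _, _, by omega, by omega, by omega, rfl⟩
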